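/- Let C ⊆ D be unital ℂ-algebras. If φ is a C-constant n-cochain on D, then Bφ := A B₀ φ is a C-constant (n−1)-cochain, where B₀φ(a⁰,…,a^{n-1}) = φ(1,a⁰,…,a^{n-1}) − (−1)ⁿ φ(a⁰,…,a^{n-1},1) and Aψ(a⁰,…,a^{n-1}) = Σⱼ₌₀^{n-1} (−1)^{(n-1)j} ψ(aʲ, aʲ⁺¹, …, aʲ⁻¹) (cyclic permutation of arguments). -/

import Mathlib

noncomputable section

variable {D : Type} [Ring D] [Algebra ℂ D]

/-- The tuple `(x⁰, …, xʲ⁻¹, y, xʲ⁺², …, xⁿ⁺¹)` obtained from `x` by replacing the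
pair `(xʲ, xʲ⁺¹)` by the single entry `y` (used with `y = xʲ xʲ⁺¹` for face maps). -/
def faceTup {α : Type} {n : ℕ} (j : Fin (n+1)) (y : α) (x : Fin (n+2) → α) :
    Fin (n+1) → α :=
  fun k => if (k : ℕ) < (j : ℕ) then x k.castSucc else if k = j then y else x k.succ

/-- The Hochschild coboundary
`bf(a⁰,…,aⁿ⁺¹) = Σⱼ (-1)ʲ f(a⁰,…,aʲaʲ⁺¹,…,aⁿ⁺¹) + (-1)ⁿ⁺¹ f(aⁿ⁺¹a⁰, a¹,…,aⁿ)`. -/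
def hbF {n : ℕ} (f : (Fin (n+1) → D) → ℂ) : (Fin (n+2) → D) → ℂ := fun x =>
  (∑ j : Fin (n+1), (-1 : ℂ) ^ (j : ℕ) * f (faceTup j (x j.castSucc * x j.succ) x))
  + (-1 : ℂ) ^ (n+1) *
      f (fun k => if (k : ℕ) = 0 then x (Fin.last (n+1)) * x 0 else x k.castSucc)

/-- `f` vanishes whenever some argument in position `≥ 1` lies in `C`. -/
def ConstVanish {m : ℕ} (C : Subalgebra ℂ D) (f : (Fin m → D) → ℂ) : Prop :=
  ∀ x : Fin m → D, (∃ j : Fin m, 0 < (j : ℕ) ∧ x j ∈ C) → f x = 0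

/-- A `C`-constant cochain: both `φ` and `bφ` vanish whenever some argument in
position `≥ 1` lies in `C`. -/
def IsConstantCochain {n : ℕ} (C : Subalgebra ℂ D)
    (φ : MultilinearMap ℂ (fun _ : Fin (n+1) => D) ℂ) : Prop :=
  ConstVanish C ⇑φ ∧ ConstVanish C (hbF ⇑φ)

/-- `B₀f(a⁰,…,aⁿ⁻¹) = f(1,a⁰,…,aⁿ⁻¹) − (−1)ⁿ f(a⁰,…,aⁿ⁻¹,1)`. -/
def hB0F {n : ℕ} (f : (Fin (n+1) → D) → ℂ) : (Fin n → D) → ℂ := fun a =>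
  f (Fin.cons 1 a) - (-1 : ℂ) ^ n * f (Fin.snoc a 1)

/-- The cyclic antisymmetrisation `Af(a⁰,…,aᵐ) = Σⱼ (−1)^{mj} f(aʲ, aʲ⁺¹, …, aʲ⁻¹)`
of a degree-`m` cochain. -/
def cycF {m : ℕ} (f : (Fin (m+1) → D) → ℂ) : (Fin (m+1) → D) → ℂ := fun a =>
  ∑ j : Fin (m+1), (-1 : ℂ) ^ (m * (j : ℕ)) * f (fun i => a (i + j))

/-- `f` is cyclically `C`-balanced. -/
def CycBal {n : ℕ} (C : Subalgebra ℂ D) (f : (Fin (n+1) → D) → ℂ) : Prop :=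
  ∀ (a : Fin (n+1) → D) (i : Fin (n+1)) (c : D), c ∈ C →
    f (Function.update a i (a i * c)) = f (Function.update a (i+1) (c * a (i+1)))

theorem hbF_key {n : ℕ} (C : Subalgebra ℂ D) (f : (Fin (n+1) → D) → ℂ)
    (hf : ConstVanish C f) (x : Fin (n+2) → D) (i : Fin (n+1)) (hx : x i.succ ∈ C) :
    hbF f x = (-1 : ℂ) ^ (i : ℕ) *
      (f (Function.update (fun k => x (i.succ.succAbove k)) i (x (i.succ.succAbove i) * x i.succ))
       - f (Function.update (fun k => x (i.succ.succAbove k)) (i+1)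
          (x i.succ * x (i.succ.succAbove (i+1))))) := by
  have hz : ∀ j : Fin (n+1), j ≠ i → (j : ℕ) ≠ i + 1 →
      (-1 : ℂ) ^ (j : ℕ) * f (faceTup j (x j.castSucc * x j.succ) x) = 0 := by
    intro j h1 h2
    have h1' : (j : ℕ) ≠ i := fun h => h1 (Fin.ext h)
    rw [hf _, mul_zero]
    rcases lt_or_gt_of_ne h1' with h | h
    · refine ⟨i, by omega, ?_⟩
      have e1 : ¬ (i : ℕ) < j := by omega
      simp only [faceTup, e1, if_false, if_neg (Ne.symm h1)]
      exact hx
    · refine ⟨⟨i + 1, by omega⟩, by simp, ?_⟩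
      have e1 : (i : ℕ) + 1 < j := by omega
      simp only [faceTup, e1, if_true]
      exact hx
  have hA : faceTup i (x i.castSucc * x i.succ) x =
      Function.update (fun k => x (i.succ.succAbove k)) i
        (x (i.succ.succAbove i) * x i.succ) := by
    funext k
    by_cases hk : k = i
    · subst hk
      simp [faceTup, Fin.succAbove, Fin.lt_def]
    · have hk' : (k : ℕ) ≠ i := fun h => hk (Fin.ext h)
      rw [Function.update_of_ne hk]
      by_cases h : (k : ℕ) < i
      · have : (k : ℕ) < i + 1 := by omega
        simp [faceTup, Fin.succAbove, Fin.lt_def, h, this]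
      · have : ¬ (k : ℕ) < i + 1 := by omega
        simp [faceTup, Fin.succAbove, Fin.lt_def, h, this, hk]
  rw [← hA]
  unfold hbF
  by_cases hl : i = Fin.last n
  · rw [Fintype.sum_eq_single i (fun j hj => hz j hj (by
      have := j.2; rw [hl]; simp; omega))]
    have hB : (fun k : Fin (n+1) => if (k : ℕ) = 0 then x (Fin.last (n+1)) * x 0 else x k.castSucc)
        = Function.update (fun k => x (i.succ.succAbove k)) (i+1)
          (x i.succ * x (i.succ.succAbove (i+1))) := by
      subst hl
      funext k
      by_cases hk : k = 0
      · subst hk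
        simp [Fin.succAbove, Fin.lt_def]
      · have hk' : (k : ℕ) ≠ 0 := fun h => hk (Fin.ext h)
        have := k.2
        have h2 : Fin.last n + 1 = 0 := by simp
        rw [h2, Function.update_of_ne hk]
        simp [hk]
    rw [hB]
    have : (i : ℕ) = n := by rw [hl]; simp
    rw [this]; ring
  · have hlt : (i : ℕ) < n := by
      have := i.2
      have : (i : ℕ) ≠ n := fun h => hl (Fin.ext h)
      omega
    have hv : ((i + 1 : Fin (n+1)) : ℕ) = i + 1 := Fin.val_add_one_of_lt (by
      rw [Fin.lt_def]; simpa using hlt)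
    have hne : i ≠ i + 1 := fun h => by
      have := congrArg Fin.val h
      omega
    rw [Fintype.sum_eq_add i (i+1) hne (fun j hj => hz j hj.1 (fun h => hj.2 (Fin.ext (by
      rw [hv]; exact h))))]
    have hlast : f (fun k : Fin (n+1) =>
        if (k : ℕ) = 0 then x (Fin.last (n+1)) * x 0 else x k.castSucc) = 0 := by
      apply hf
      refine ⟨i + 1, by omega, ?_⟩
      have e : (i + 1).castSucc = i.succ := Fin.ext (by simp [hv])
      rw [if_neg (by omega), e]
      exact hx
    have hB : faceTup (i+1) (x (i+1).castSucc * x (i+1).succ) x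
        = Function.update (fun k => x (i.succ.succAbove k)) (i+1)
          (x i.succ * x (i.succ.succAbove (i+1))) := by
      have e : (i + 1).castSucc = i.succ := Fin.ext (by simp [hv])
      funext k
      by_cases hk : k = i + 1
      · subst hk
        rw [Function.update_self, e]
        simp [faceTup, Fin.succAbove, e]
      · have hk' : (k : ℕ) ≠ i + 1 := fun h => hk (Fin.ext (by omega))
        rw [Function.update_of_ne hk]
        by_cases h : (k : ℕ) < i + 1
        · simp [faceTup, Fin.succAbove, Fin.lt_def, h, hv]
        · simp [faceTup, Fin.succAbove, Fin.lt_def, h, hv, hk]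
    rw [hlast, hB, hv]
    ring

theorem balanced_of_const {n : ℕ} (C : Subalgebra ℂ D) (f : (Fin (n+1) → D) → ℂ)
    (hf : ConstVanish C f) (hb : ConstVanish C (hbF f)) : CycBal C f := by
  intro a i c hc
  have h1 := hb (Fin.insertNth (α := fun _ => D) i.succ c a) ⟨i.succ, by simp, by simpa using hc⟩
  rw [hbF_key C f hf _ i (by simpa using hc)] at h1
  simp only [Fin.insertNth_apply_succAbove, Fin.insertNth_apply_same] at h1
  rcases mul_eq_zero.1 h1 with h | h
  · exact absurd h (by simp)
  · exact sub_eq_zero.1 h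

theorem const_of_balanced {n : ℕ} (C : Subalgebra ℂ D) (f : (Fin (n+1) → D) → ℂ)
    (hf : ConstVanish C f) (hb : CycBal C f) : ConstVanish C (hbF f) := by
  rintro x ⟨j, hj, hx⟩
  obtain ⟨i, rfl⟩ := Fin.exists_succ_eq.2 (show j ≠ 0 by rintro rfl; simp at hj)
  rw [hbF_key C f hf x i hx, hb (fun k => x (i.succ.succAbove k)) i _ hx, sub_self, mul_zero]

theorem balanced_cycF {n : ℕ} (C : Subalgebra ℂ D) (f : (Fin (n+1) → D) → ℂ)
    (hb : CycBal C f) : CycBal C (cycF f) := by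
  have hu : ∀ (a : Fin (n+1) → D) (i j : Fin (n+1)) (y : D),
      (fun k => Function.update a i y (k + j))
        = Function.update (fun k => a (k + j)) (i - j) y := by
    intro a i j y
    funext k
    by_cases h : k = i - j
    · subst h; simp
    · have : k + j ≠ i := fun h' => h (eq_sub_of_add_eq h')
      rw [Function.update_of_ne h, Function.update_of_ne this]
  intro a i c hc
  unfold cycF
  refine Finset.sum_congr rfl fun j _ => ?_
  rw [hu, hu]
  have := hb (fun k => a (k + j)) (i - j) c hc
  have e : i - j + 1 + j = i + 1 := by abel
  have e2 : i - j + 1 = i + 1 - j := by abel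
  simp only [sub_add_cancel, e] at this
  rw [this, e2]

theorem statement7 {m : ℕ} (C : Subalgebra ℂ D)
    (φ : MultilinearMap ℂ (fun _ : Fin (m+2) => D) ℂ)
    (hφ : IsConstantCochain C φ) :
    ConstVanish C (cycF (hB0F ⇑φ)) ∧ ConstVanish C (hbF (cycF (hB0F ⇑φ))) := by
  obtain ⟨h1, h2⟩ := hφ
  have hB := balanced_of_const C _ h1 h2
  have h0 : ∀ a : Fin (m+1) → D, hB0F (⇑φ) a = φ (Fin.cons 1 a) := by
    intro a
    unfold hB0F
    rw [h1 (Fin.snoc a 1) ⟨Fin.last (m+1), by simp, by simpa using C.one_mem⟩]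
    simp
  have hvan : ∀ a : Fin (m+1) → D, (∃ j, a j ∈ C) → hB0F (⇑φ) a = 0 := by
    rintro a ⟨j, hj⟩
    rw [h0]
    exact h1 _ ⟨j.succ, by simp, by simpa using hj⟩
  have hbal : CycBal C (hB0F (⇑φ)) := by
    intro a i c hc
    rw [h0, h0, Fin.cons_update, Fin.cons_update]
    have k1 := hB (Fin.cons 1 a) i.succ c hc
    rw [Fin.cons_succ] at k1
    rw [k1]
    by_cases hl : i = Fin.last m
    · subst hl
      have k2 := hB (Fin.cons 1 a) 0 c hc
      have e : (Fin.last m).succ + 1 = 0 := by simp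
      have e1 : (0 : Fin (m+2)) + 1 = (0 : Fin (m+1)).succ := by simp
      have e2 : Fin.last m + 1 = 0 := by simp
      rw [e1, Fin.cons_succ, Fin.cons_zero, one_mul] at k2
      rw [e, e2, Fin.cons_zero, mul_one, k2]
    · have hlt : i < Fin.last m := Fin.lt_last_iff_ne_last.2 hl
      have e : i.succ + 1 = (i + 1).succ := by
        apply Fin.ext
        rw [Fin.val_add_one_of_lt, Fin.val_succ, Fin.val_succ, Fin.val_add_one_of_lt hlt]
        rw [Fin.lt_def] at *
        simpa using hlt
      rw [e, Fin.cons_succ]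
  have hc : ConstVanish C (cycF (hB0F ⇑φ)) := by
    rintro x ⟨j, -, hj⟩
    unfold cycF
    refine Finset.sum_eq_zero fun k _ => ?_
    rw [hvan _ ⟨j - k, by simpa using hj⟩, mul_zero]
  exact ⟨hc, const_of_balanced C _ hc (balanced_cycF C _ hbal)⟩
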